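/- arXiv:1102.1822 — 2 statements merged into one kernel-verified Lean document; each statement's English description precedes it below -/
import Mathlib

section
/- Let H be an n×n real matrix all of whose (complex) eigenvalues h satisfy 0 < Re(h) < 1, let D := H − (1/2)I, and let A be an n×n complex matrix such that Re(AA^*) := (1/2)(AA^* + \overline{AA^*}) is invertible. Then for every t ∈ ℝ \ {0}, the matrix Γ(t) := ∫_ℝ |(e^{itx} − 1)/x|² · ( x_+^{−D} (AA^*) x_+^{−D^*} + x_−^{−D} (\overline{AA^*}) x_−^{−D^*} ) dx is Hermitian positive definite; in particular it is invertible. -/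
open MeasureTheory Matrix
open scoped ComplexOrder

/-- `x₊^B := exp((log x) B)` (matrix exponential) for `x > 0`, and the zero matrix otherwise.
The quantity `x₊^{-D}` of the paper is `matPosPow x (-D)`. -/
noncomputable def matPosPow {n : ℕ} (x : ℝ) (B : Matrix (Fin n) (Fin n) ℂ) :
    Matrix (Fin n) (Fin n) ℂ :=
  if 0 < x then NormedSpace.exp ((Real.log x : ℂ) • B) else 0

/-- The spectral-density-type matrix kernel
`f(x) = |(e^{itx}-1)/x|² (x₊^{-D} (AA^*) x₊^{-D^*} + x₋^{-D} (conj (AA^*)) x₋^{-D^*})`. -/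
noncomputable def specKernel {n : ℕ} (D : Matrix (Fin n) (Fin n) ℂ)
    (A : Matrix (Fin n) (Fin n) ℂ) (t : ℝ) (x : ℝ) : Matrix (Fin n) (Fin n) ℂ :=
  ((‖(Complex.exp (Complex.I * t * x) - 1) / (x : ℂ)‖ ^ 2 : ℝ) : ℂ) •
    (matPosPow x (-D) * (A * Aᴴ) * matPosPow x (-Dᴴ) +
      matPosPow (-x) (-D) * (A * Aᴴ).map (starRingEnd ℂ) * matPosPow (-x) (-Dᴴ))

open scoped Matrix.Norms.Operator in
/-- The exponential series of `N`, applied to a vector killed by `N ^ k`, is a finite sum. -/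
lemma exp_mulVec_eq_sum {n : ℕ} (N : Matrix (Fin n) (Fin n) ℂ) (v : Fin n → ℂ) (k : ℕ)
    (hv : N ^ k *ᵥ v = 0) :
    NormedSpace.exp N *ᵥ v =
      ∑ j ∈ Finset.range k, ((j.factorial : ℂ)⁻¹) • (N ^ j *ᵥ v) := by
  have h := NormedSpace.exp_series_hasSum_exp' (𝕂 := ℂ) N
  have h1 := h.map ((Matrix.mulVecBilin ℂ ℂ).flip v) (by
    simp only [Matrix.mulVecBilin, LinearMap.flip]
    exact Continuous.matrix_mulVec continuous_id continuous_const)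
  refine h1.unique ?_
  have h2 : ∀ j ∉ Finset.range k,
      ((Matrix.mulVecBilin ℂ ℂ).flip v ∘ fun j : ℕ => ((j.factorial : ℂ)⁻¹) • N ^ j) j = 0 := by
    intro j hj
    obtain ⟨m, rfl⟩ := Nat.exists_eq_add_of_le (not_lt.mp (Finset.mem_range.not.mp hj))
    simp [add_comm k m, pow_add, hv]
  simpa [Matrix.smul_mulVec] using hasSum_sum_of_ne_finset_zero h2

open scoped Matrix.Norms.Operator in
/-- Splitting off an eigenvalue `μ` from the matrix exponential. -/
lemma exp_smul_eq_cexp_smul_exp {n : ℕ} (B : Matrix (Fin n) (Fin n) ℂ) (μ s : ℂ) :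
    NormedSpace.exp (s • B) = Complex.exp (s * μ) • NormedSpace.exp (s • (B - μ • 1)) := by
  have h : s • B = algebraMap ℂ (Matrix (Fin n) (Fin n) ℂ) (s * μ) + s • (B - μ • 1) := by
    rw [Algebra.algebraMap_eq_smul_one]
    module
  rw [h, Matrix.exp_add_of_commute _ _ (Algebra.commute_algebraMap_left _ _),
    Complex.exp_eq_exp_ℂ, Algebra.smul_def (NormedSpace.exp (s * μ))]
  exact congrArg (· * NormedSpace.exp (s • (B - μ • 1)))
    (NormedSpace.algebraMap_exp_comm (s * μ)).symm

/-- Polynomial growth is absorbed by a faster exponential. -/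
lemma pow_mul_exp_le {δ s : ℝ} (hδ : 0 < δ) (hs : 0 ≤ s) (j : ℕ) :
    s ^ j ≤ (j.factorial / δ ^ j) * Real.exp (δ * s) := by
  have h := Real.pow_div_factorial_le_exp (δ * s) (mul_nonneg hδ.le hs) j
  rw [mul_pow, div_le_iff₀ (by positivity)] at h
  rw [div_mul_eq_mul_div, le_div_iff₀ (by positivity)]
  linarith

lemma exists_norm_exp_smul_mulVec_le_of_pow_eq_zero {n : ℕ} (B : Matrix (Fin n) (Fin n) ℂ)
    {β : ℝ} {μ : ℂ} (hμ : μ.re < β) (v : Fin n → ℂ) (k : ℕ) (hv : (B - μ • 1) ^ k *ᵥ v = 0) :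
    ∃ C : ℝ, ∀ s : ℝ, 0 ≤ s →
      ‖NormedSpace.exp ((s : ℂ) • B) *ᵥ v‖ ≤ C * Real.exp (s * β) := by
  set N := B - μ • (1 : Matrix (Fin n) (Fin n) ℂ)
  refine ⟨∑ j ∈ Finset.range k, (1 / (β - μ.re) ^ j) * ‖N ^ j *ᵥ v‖, fun s hs => ?_⟩
  have hN : ((s : ℂ) • N) ^ k *ᵥ v = 0 := by rw [smul_pow, smul_mulVec, hv, smul_zero]
  rw [exp_smul_eq_cexp_smul_exp B μ, smul_mulVec, exp_mulVec_eq_sum _ v k hN, norm_smul,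
    Complex.norm_exp, Finset.sum_mul]
  have he : Real.exp (s * β) = Real.exp (s * μ.re) * Real.exp ((β - μ.re) * s) := by
    rw [← Real.exp_add]
    ring_nf
  have hre : ((s : ℂ) * μ).re = s * μ.re := by simp
  rw [hre]
  calc Real.exp (s * μ.re) *
        ‖∑ j ∈ Finset.range k, ((j.factorial : ℂ)⁻¹) • (((s : ℂ) • N) ^ j *ᵥ v)‖
      ≤ Real.exp (s * μ.re) *
        ∑ j ∈ Finset.range k, ‖((j.factorial : ℂ)⁻¹) • (((s : ℂ) • N) ^ j *ᵥ v)‖ := by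
        gcongr
        exact norm_sum_le _ _
    _ ≤ _ := by
        rw [Finset.mul_sum]
        refine Finset.sum_le_sum fun j _ => ?_
        rw [smul_pow, smul_mulVec, norm_smul, norm_smul, norm_inv, norm_pow, Complex.norm_real,
          Complex.norm_natCast, Real.norm_of_nonneg hs, he]
        have h := pow_mul_exp_le (sub_pos.mpr hμ) hs j
        calc Real.exp (s * μ.re) * ((j.factorial : ℝ)⁻¹ * (s ^ j * ‖N ^ j *ᵥ v‖))
            ≤ Real.exp (s * μ.re) * ((j.factorial : ℝ)⁻¹ *
              (((j.factorial / (β - μ.re) ^ j) * Real.exp ((β - μ.re) * s)) *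
                ‖N ^ j *ᵥ v‖)) := by gcongr
          _ = _ := by field_simp

lemma exists_norm_exp_smul_mulVec_le {n : ℕ} (B : Matrix (Fin n) (Fin n) ℂ) {β : ℝ}
    (hB : ∀ μ ∈ spectrum ℂ B, μ.re < β) (v : Fin n → ℂ) :
    ∃ C : ℝ, ∀ s : ℝ, 0 ≤ s →
      ‖NormedSpace.exp ((s : ℂ) • B) *ᵥ v‖ ≤ C * Real.exp (s * β) := by
  have hv : v ∈ ⨆ μ : ℂ, Module.End.maxGenEigenspace (Matrix.toLin' B) μ := by
    rw [Module.End.iSup_maxGenEigenspace_eq_top]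
    trivial
  induction hv using Submodule.iSup_induction' with
  | mem μ v hv =>
    obtain ⟨k, hk⟩ := (Module.End.mem_maxGenEigenspace _ _ _).mp hv
    have hk' : (B - μ • 1) ^ k *ᵥ v = 0 := by
      rw [← hk, ← Matrix.toLin'_apply, Matrix.toLin'_pow, map_sub, map_smul, Matrix.toLin'_one]
      rfl
    by_cases hμ : μ ∈ spectrum ℂ B
    · exact exists_norm_exp_smul_mulVec_le_of_pow_eq_zero B (hB μ hμ) v k hk'
    · rw [spectrum.notMem_iff, Algebra.algebraMap_eq_smul_one, ← IsUnit.neg_iff, neg_sub] at hμ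
      have hv0 : v = 0 := by
        refine Matrix.mulVec_injective_iff_isUnit.mpr (hμ.pow k) ?_
        rw [hk', mulVec_zero]
      exact ⟨0, fun s _ => by simp [hv0]⟩
  | zero => exact ⟨0, fun s _ => by simp⟩
  | add v w _ _ hv hw =>
    obtain ⟨C, hC⟩ := hv
    obtain ⟨C', hC'⟩ := hw
    refine ⟨C + C', fun s hs => ?_⟩
    rw [mulVec_add, add_mul]
    exact (norm_add_le _ _).trans (add_le_add (hC s hs) (hC' s hs))

/-- If all eigenvalues of `B` have real part less than `β`, then the entries of `exp (s B)` are
`O(exp (s β))` for `s ≥ 0`. -/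
lemma exists_norm_exp_smul_apply_le {n : ℕ} (B : Matrix (Fin n) (Fin n) ℂ) {β : ℝ}
    (hB : ∀ μ ∈ spectrum ℂ B, μ.re < β) :
    ∃ C : ℝ, ∀ s : ℝ, 0 ≤ s → ∀ i j,
      ‖NormedSpace.exp ((s : ℂ) • B) i j‖ ≤ C * Real.exp (s * β) := by
  choose C hC using fun j => exists_norm_exp_smul_mulVec_le B hB (Pi.single j 1)
  refine ⟨∑ j, |C j|, fun s hs i j => ?_⟩
  have h := (norm_le_pi_norm _ i).trans (hC j s hs)
  rw [mulVec_single_one] at h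
  refine h.trans ?_
  gcongr
  exact (le_abs_self _).trans
    (Finset.single_le_sum (f := fun j => |C j|) (fun _ _ => abs_nonneg _) (Finset.mem_univ j))

open scoped Matrix.Norms.Operator in
lemma continuous_exp_smul_apply {n : ℕ} (B : Matrix (Fin n) (Fin n) ℂ) (i j : Fin n) :
    Continuous fun s : ℝ => NormedSpace.exp ((s : ℂ) • B) i j := by
  have h : Continuous fun s : ℝ => NormedSpace.exp ((s : ℂ) • B) :=
    NormedSpace.exp_continuous.comp (Complex.continuous_ofReal.smul continuous_const)
  exact h.matrix_elem i j

/-- If the eigenvalues of `B` have real part in `(-1/2, 1/2)`, then the entries of `exp (s B)` are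
`O(exp (β |s|))` for some `β < 1/2`. -/
lemma exists_norm_exp_smul_apply_le_abs {n : ℕ} (B : Matrix (Fin n) (Fin n) ℂ)
    (hB : ∀ μ ∈ spectrum ℂ B, |μ.re| < 1 / 2) :
    ∃ β : ℝ, β < 1 / 2 ∧ ∃ C : ℝ, ∀ s : ℝ, ∀ i j,
      ‖NormedSpace.exp ((s : ℂ) • B) i j‖ ≤ C * Real.exp (β * |s|) := by
  have hev : ∀ᶠ β in nhdsWithin (1 / 2 : ℝ) (Set.Iio (1 / 2)),
      (∀ μ ∈ spectrum ℂ B, |μ.re| < β) ∧ β < 1 / 2 := by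
    refine Filter.Eventually.and ?_ self_mem_nhdsWithin
    rw [Filter.eventually_all_finite B.finite_spectrum]
    exact fun μ hμ => nhdsWithin_le_nhds (eventually_gt_nhds (hB μ hμ))
  obtain ⟨β, hβ, hβ1⟩ := hev.exists
  obtain ⟨C, hC⟩ := exists_norm_exp_smul_apply_le B
    fun μ hμ => (le_abs_self _).trans_lt (hβ μ hμ)
  obtain ⟨C', hC'⟩ := exists_norm_exp_smul_apply_le (-B) (β := β) fun μ hμ => by
    rw [← spectrum.neg_eq, Set.mem_neg] at hμ
    have h := (neg_le_abs _).trans_lt (hβ _ hμ)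
    simpa using h
  refine ⟨β, hβ1, max C C', fun s i j => ?_⟩
  rcases le_total 0 s with hs | hs
  · rw [abs_of_nonneg hs, mul_comm β]
    refine (hC s hs i j).trans ?_
    gcongr
    exact le_max_left _ _
  · have h := hC' (-s) (neg_nonneg.mpr hs) i j
    rw [Complex.ofReal_neg, neg_smul_neg] at h
    rw [abs_of_nonpos hs, mul_comm β]
    refine h.trans ?_
    gcongr
    exact le_max_right _ _

lemma norm_cexp_I_sub_one_div (t x : ℝ) :
    ‖(Complex.exp (Complex.I * t * x) - 1) / (x : ℂ)‖ ^ 2 = (2 * Real.sin (t * x / 2) / x) ^ 2 := by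
  rw [mul_assoc, ← Complex.ofReal_mul, norm_div, Complex.norm_exp_I_mul_ofReal_sub_one,
    Complex.norm_real, ← norm_div, Real.norm_eq_abs, sq_abs]

/-- The function `(2 sin (t x / 2) / x) ^ 2 * exp (b |log x|)`, which behaves like `|x| ^ (-b)` near
the origin and is `O(|x| ^ (b - 2))` at infinity, is integrable for `b < 1`. -/
lemma integrable_sin_div_sq_mul_exp_abs_log (t : ℝ) {b : ℝ} (hb : b < 1) :
    Integrable fun x : ℝ =>
      (2 * Real.sin (t * x / 2) / x) ^ 2 * Real.exp (b * |Real.log x|) := by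
  set g : ℝ → ℝ := fun x => (2 * Real.sin (t * x / 2) / x) ^ 2 * Real.exp (b * |Real.log x|)
    with hg
  have hmeas : Measurable g := by fun_prop
  have hg0 : ∀ x, 0 ≤ g x := fun x => by positivity
  have hsmall : IntegrableOn g (Set.Ioc 0 1) := by
    have h : IntegrableOn (fun x : ℝ => t ^ 2 * x ^ (-b)) (Set.Ioc 0 1) :=
      Integrable.const_mul ((intervalIntegrable_iff_integrableOn_Ioc_of_le zero_le_one).mp
        (intervalIntegral.intervalIntegrable_rpow' (by linarith))) _
    refine Integrable.mono' h hmeas.aestronglyMeasurable ?_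
    refine (ae_restrict_iff' measurableSet_Ioc).mpr (.of_forall fun x hx => ?_)
    rw [Real.norm_of_nonneg (hg0 x), hg]
    have hlog : Real.exp (b * |Real.log x|) = x ^ (-b) := by
      rw [abs_of_nonpos (Real.log_nonpos hx.1.le hx.2), Real.rpow_def_of_pos hx.1]
      ring_nf
    simp only [hlog]
    have hx0 := hx.1
    gcongr ?_ * _
    rw [← sq_abs t, ← sq_abs (_ / x), abs_div, div_pow, div_le_iff₀ (by positivity), ← mul_pow,
      ← abs_mul, abs_mul 2]
    gcongr
    have := Real.abs_sin_le_abs (x := t * x / 2)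
    rw [abs_div] at this
    norm_num at this ⊢
    linarith
  have hlarge : IntegrableOn g (Set.Ioi 1) := by
    have h : IntegrableOn (fun x : ℝ => 4 * x ^ (b - 2)) (Set.Ioi 1) :=
      Integrable.const_mul (integrableOn_Ioi_rpow_of_lt (by linarith) zero_lt_one) _
    refine Integrable.mono' h hmeas.aestronglyMeasurable ?_
    refine (ae_restrict_iff' measurableSet_Ioi).mpr (.of_forall fun x hx => ?_)
    have hx0 : 0 < x := zero_lt_one.trans hx
    rw [Real.norm_of_nonneg (hg0 x), hg]
    have hlog : Real.exp (b * |Real.log x|) = x ^ b := by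
      rw [abs_of_nonneg (Real.log_nonneg (le_of_lt hx)), Real.rpow_def_of_pos hx0]
      ring_nf
    simp only [hlog]
    rw [Real.rpow_sub hx0, Real.rpow_two, ← mul_div_assoc, div_pow, div_mul_eq_mul_div, mul_pow]
    gcongr ?_ / _
    gcongr ?_ * _
    nlinarith [Real.sin_sq_le_one (t * x / 2)]
  have hpos : IntegrableOn g (Set.Ioi 0) := by
    rw [← Set.Ioc_union_Ioi_eq_Ioi zero_le_one]
    exact hsmall.union hlarge
  have heven : ∀ x, g (-x) = g x := fun x => by simp [hg, neg_div, div_neg]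
  rw [← integrableOn_univ, ← Set.Iic_union_Ioi (a := (0 : ℝ))]
  refine IntegrableOn.union ?_ hpos
  have hneg : MeasurableEmbedding (Neg.neg : ℝ → ℝ) := (Homeomorph.neg ℝ).measurableEmbedding
  rw [← Measure.map_neg_eq_self (volume : Measure ℝ), hneg.integrableOn_map_iff]
  simpa [Function.comp_def, heven, integrableOn_Ici_iff_integrableOn_Ioi] using hpos

lemma matPosPow_conjTranspose {n : ℕ} (x : ℝ) (B : Matrix (Fin n) (Fin n) ℂ) :
    matPosPow x Bᴴ = (matPosPow x B)ᴴ := by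
  unfold matPosPow
  split_ifs
  · rw [← Matrix.exp_conjTranspose, conjTranspose_smul, Complex.star_def, Complex.conj_ofReal]
  · rw [conjTranspose_zero]

lemma measurable_matPosPow_apply {n : ℕ} (B : Matrix (Fin n) (Fin n) ℂ) (i j : Fin n) :
    Measurable fun x => matPosPow x B i j := by
  have h : (fun x => matPosPow x B i j) = fun x : ℝ =>
      if 0 < x then NormedSpace.exp ((Real.log x : ℂ) • B) i j else 0 := by
    funext x
    unfold matPosPow
    split_ifs <;> rfl
  rw [h]
  exact Measurable.ite measurableSet_Ioi
    ((continuous_exp_smul_apply B i j).measurable.comp Real.measurable_log) measurable_const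

lemma map_conj_mul_conjTranspose {n : ℕ} (A : Matrix (Fin n) (Fin n) ℂ) :
    (A * Aᴴ).map (starRingEnd ℂ) =
      A.map (starRingEnd ℂ) * (A.map (starRingEnd ℂ))ᴴ := by
  rw [Matrix.map_mul]
  rfl

lemma specKernel_eq {n : ℕ} (D A : Matrix (Fin n) (Fin n) ℂ) (t x : ℝ) :
    specKernel D A t x = (((2 * Real.sin (t * x / 2) / x) ^ 2 : ℝ) : ℂ) •
      (matPosPow x (-D) * (A * Aᴴ) * (matPosPow x (-D))ᴴ +
        matPosPow (-x) (-D) * (A * Aᴴ).map (starRingEnd ℂ) * (matPosPow (-x) (-D))ᴴ) := by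
  rw [specKernel, norm_cexp_I_sub_one_div, ← conjTranspose_neg, matPosPow_conjTranspose,
    matPosPow_conjTranspose]

lemma specKernel_posSemidef {n : ℕ} (D A : Matrix (Fin n) (Fin n) ℂ) (t x : ℝ) :
    (specKernel D A t x).PosSemidef := by
  rw [specKernel_eq, map_conj_mul_conjTranspose]
  refine PosSemidef.smul (PosSemidef.add ?_ ?_) (Complex.zero_le_real.mpr (sq_nonneg _))
  · exact (posSemidef_self_mul_conjTranspose A).mul_mul_conjTranspose_same _
  · exact (posSemidef_self_mul_conjTranspose _).mul_mul_conjTranspose_same _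

lemma norm_mul_mul_conjTranspose_apply_le {n : ℕ} (P M : Matrix (Fin n) (Fin n) ℂ) {R : ℝ}
    (hP : ∀ i j, ‖P i j‖ ≤ R) (i j : Fin n) :
    ‖(P * M * Pᴴ) i j‖ ≤ (∑ l, ∑ k, ‖M k l‖) * R ^ 2 := by
  rw [Matrix.mul_apply, Finset.sum_mul]
  refine (norm_sum_le _ _).trans (Finset.sum_le_sum fun l _ => ?_)
  rw [Matrix.mul_apply, Finset.sum_mul, Finset.sum_mul]
  refine (norm_sum_le _ _).trans (Finset.sum_le_sum fun k _ => ?_)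
  rw [conjTranspose_apply, norm_mul, norm_mul, norm_star]
  have hR : 0 ≤ R := (norm_nonneg _).trans (hP i k)
  calc ‖P i k‖ * ‖M k l‖ * ‖P j l‖ ≤ R * ‖M k l‖ * R := by
        gcongr
        exacts [hP i k, hP j l]
    _ = _ := by ring

lemma measurable_mul_mul_conjTranspose_apply {n : ℕ} {P : ℝ → Matrix (Fin n) (Fin n) ℂ}
    (hP : ∀ i j, Measurable fun x => P x i j) (M : Matrix (Fin n) (Fin n) ℂ) (i j : Fin n) :
    Measurable fun x => (P x * M * (P x)ᴴ) i j := by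
  simp only [Matrix.mul_apply, conjTranspose_apply]
  exact Finset.measurable_fun_sum _ fun l _ => Measurable.mul
    (Finset.measurable_fun_sum _ fun k _ => (hP i k).mul_const _)
    (Complex.continuous_conj.measurable.comp (hP j l))

lemma integrable_specKernel_apply {n : ℕ} {D : Matrix (Fin n) (Fin n) ℂ}
    (hD : ∀ μ ∈ spectrum ℂ D, |μ.re| < 1 / 2) (A : Matrix (Fin n) (Fin n) ℂ) (t : ℝ)
    (i j : Fin n) : Integrable fun x => specKernel D A t x i j := by
  have hD' : ∀ μ ∈ spectrum ℂ (-D), |μ.re| < 1 / 2 := fun μ hμ => by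
    rw [← spectrum.neg_eq, Set.mem_neg] at hμ
    simpa using hD _ hμ
  obtain ⟨β, hβ1, C, hC⟩ := exists_norm_exp_smul_apply_le_abs (-D) hD'
  have hP : ∀ x : ℝ, ∀ i j, ‖matPosPow x (-D) i j‖ ≤ C * Real.exp (β * |Real.log x|) := by
    intro x i j
    have h := hC (Real.log x) i j
    unfold matPosPow
    split_ifs
    · exact h
    · simpa using (norm_nonneg _).trans h
  have hg := (integrable_sin_div_sq_mul_exp_abs_log t (b := 2 * β) (by linarith)).const_mul
    (((∑ l, ∑ k, ‖(A * Aᴴ) k l‖) + ∑ l, ∑ k, ‖(A * Aᴴ).map (starRingEnd ℂ) k l‖) * C ^ 2)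
  refine hg.mono' ?_ (.of_forall fun x => ?_)
  · refine Measurable.aestronglyMeasurable ?_
    simp only [specKernel_eq, Matrix.smul_apply, Matrix.add_apply, smul_eq_mul]
    have h := measurable_matPosPow_apply (-D)
    refine Measurable.mul (by fun_prop) (Measurable.add ?_ ?_)
    · exact measurable_mul_mul_conjTranspose_apply h _ i j
    · exact measurable_mul_mul_conjTranspose_apply (fun i j => (h i j).comp measurable_neg) _ i j
  · have h1 := norm_mul_mul_conjTranspose_apply_le _ (A * Aᴴ) (hP x) i j
    have h2 := norm_mul_mul_conjTranspose_apply_le _ ((A * Aᴴ).map (starRingEnd ℂ)) (hP (-x)) i j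
    rw [Real.log_neg_eq_log] at h2
    rw [specKernel_eq, Matrix.smul_apply, Matrix.add_apply, norm_smul, Complex.norm_real,
      Real.norm_of_nonneg (sq_nonneg _)]
    have he : Real.exp (2 * β * |Real.log x|) = Real.exp (β * |Real.log x|) ^ 2 := by
      rw [← Real.exp_nat_mul]
      push_cast
      ring_nf
    refine (mul_le_mul_of_nonneg_left ((norm_add_le _ _).trans (add_le_add h1 h2))
      (sq_nonneg _)).trans (le_of_eq ?_)
    rw [he]
    ring

/-- The entrywise integral of a family of positive semidefinite matrices is positive definite if no
nonzero vector is almost everywhere isotropic. -/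
lemma posDef_of_integral {n : ℕ} {α : Type*} [MeasurableSpace α] {μ : Measure α}
    {K : α → Matrix (Fin n) (Fin n) ℂ} (hK : ∀ i j, Integrable (fun x => K x i j) μ)
    (hpos : ∀ x, (K x).PosSemidef)
    (hne : ∀ v : Fin n → ℂ, v ≠ 0 → ¬ ∀ᵐ x ∂μ, star v ⬝ᵥ (K x *ᵥ v) = 0) :
    (Matrix.of fun i j => ∫ x, K x i j ∂μ).PosDef := by
  refine PosDef.of_dotProduct_mulVec_pos ?_ fun v hv => ?_
  · ext i j
    rw [conjTranspose_apply, of_apply, of_apply, Complex.star_def, ← integral_conj]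
    exact integral_congr_ae (.of_forall fun x => (hpos x).1.apply i j)
  have hsum : ∀ x, star v ⬝ᵥ (K x *ᵥ v) = ∑ i, ∑ j, star (v i) * (K x i j * v j) := fun x => by
    simp [dotProduct, mulVec, Finset.mul_sum]
  have hterm : ∀ i j, Integrable (fun x => star (v i) * (K x i j * v j)) μ :=
    fun i j => ((hK i j).mul_const _).const_mul _
  have hint : Integrable (fun x => star v ⬝ᵥ (K x *ᵥ v)) μ := by
    simp only [hsum]
    exact integrable_finsetSum _ fun i _ => integrable_finsetSum _ fun j _ => hterm i j
  have hquad : star v ⬝ᵥ ((Matrix.of fun i j => ∫ x, K x i j ∂μ) *ᵥ v) =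
      ∫ x, star v ⬝ᵥ (K x *ᵥ v) ∂μ := by
    simp only [hsum]
    rw [integral_finsetSum _ fun i _ => integrable_finsetSum _ fun j _ => hterm i j]
    simp only [dotProduct, mulVec, Finset.mul_sum, of_apply, Pi.star_apply]
    refine Finset.sum_congr rfl fun i _ => ?_
    rw [integral_finsetSum _ fun j _ => hterm i j]
    refine Finset.sum_congr rfl fun j _ => ?_
    rw [integral_const_mul, integral_mul_const]
  have hre : ∀ x, star v ⬝ᵥ (K x *ᵥ v) = ((star v ⬝ᵥ (K x *ᵥ v)).re : ℂ) := fun x =>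
    Complex.ext rfl (by simpa using ((Complex.le_def.mp
      ((hpos x).dotProduct_mulVec_nonneg v)).2).symm)
  have hnn : ∀ x, 0 ≤ (star v ⬝ᵥ (K x *ᵥ v)).re := fun x =>
    (Complex.le_def.mp ((hpos x).dotProduct_mulVec_nonneg v)).1
  rw [hquad, integral_congr_ae (.of_forall hre), integral_complex_ofReal]
  refine Complex.zero_lt_real.mpr ((integral_nonneg hnn).lt_of_ne' fun h0 => hne v hv ?_)
  rw [integral_eq_zero_iff_of_nonneg hnn hint.re] at h0
  filter_upwards [h0] with x hx
  rw [hre x]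
  simpa using hx

/-- For `0 < x < 1 / |t|`, the kernels at `x` and `-x` add up to a positive definite matrix. -/
lemma specKernel_add_specKernel_neg_posDef {n : ℕ} (D A : Matrix (Fin n) (Fin n) ℂ)
    (hA : IsUnit ((1/2 : ℂ) • (A * Aᴴ + (A * Aᴴ).map (starRingEnd ℂ)))) {t : ℝ} (ht : t ≠ 0)
    {x : ℝ} (hx0 : 0 < x) (hx1 : x < 1 / |t|) :
    (specKernel D A t x + specKernel D A t (-x)).PosDef := by
  have hRe : (A * Aᴴ + (A * Aᴴ).map (starRingEnd ℂ)).PosDef := by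
    have hunit : IsUnit (A * Aᴴ + (A * Aᴴ).map (starRingEnd ℂ)) := by
      simpa using hA.smul (Units.mk0 (2 : ℂ) two_ne_zero)
    refine (PosSemidef.posDef_iff_isUnit ?_).mpr hunit
    rw [map_conj_mul_conjTranspose]
    exact (posSemidef_self_mul_conjTranspose _).add (posSemidef_self_mul_conjTranspose _)
  have hneg : matPosPow (-x) (-D) = 0 := if_neg (by linarith)
  have hunit : IsUnit (matPosPow x (-D)) := by
    rw [matPosPow, if_pos hx0]
    exact Matrix.isUnit_exp _
  have hsin : Real.sin (t * x / 2) ≠ 0 := by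
    have habs : |t * x / 2| < 1 := by
      rw [lt_div_iff₀ (abs_pos.mpr ht)] at hx1
      rw [abs_div, abs_mul, abs_of_pos hx0, abs_two]
      linarith
    obtain ⟨h1, h2⟩ := abs_lt.mp habs
    rw [Ne, Real.sin_eq_zero_iff_of_lt_of_lt (by linarith [Real.pi_gt_three])
      (by linarith [Real.pi_gt_three])]
    positivity
  have heq : specKernel D A t x + specKernel D A t (-x) =
      (((2 * Real.sin (t * x / 2) / x) ^ 2 : ℝ) : ℂ) •
        (matPosPow x (-D) * (A * Aᴴ + (A * Aᴴ).map (starRingEnd ℂ)) * (matPosPow x (-D))ᴴ) := by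
    rw [specKernel_eq, specKernel_eq, neg_neg, hneg]
    simp [neg_div, div_neg, Matrix.mul_add, Matrix.add_mul, smul_add]
  rw [heq]
  refine (hRe.mul_mul_conjTranspose_same (vecMul_injective_iff_isUnit.mpr hunit)).smul ?_
  have : 2 * Real.sin (t * x / 2) / x ≠ 0 := by positivity
  exact_mod_cast sq_pos_of_ne_zero this

/-- Let `H` be a real `n×n` matrix with all eigenvalues satisfying `0 < Re h < 1`, let
`D = H - (1/2) I`, and let `A` be a complex matrix with `Re(AA^*) = (1/2)(AA^* + conj (AA^*))`
invertible. Then for every `t ≠ 0` the matrix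
`Γ(t) = ∫ |(e^{itx}-1)/x|² (x₊^{-D} (AA^*) x₊^{-D^*} + x₋^{-D} (conj (AA^*)) x₋^{-D^*}) dx`
is Hermitian positive definite; in particular it is invertible. -/
theorem stmt7 (n : ℕ) (H : Matrix (Fin n) (Fin n) ℝ)
    (hH : ∀ h ∈ spectrum ℂ (H.map (Complex.ofReal)), 0 < h.re ∧ h.re < 1)
    (D : Matrix (Fin n) (Fin n) ℂ)
    (hD : D = H.map (Complex.ofReal) - (1/2 : ℂ) • 1)
    (A : Matrix (Fin n) (Fin n) ℂ)
    (hA : IsUnit ((1/2 : ℂ) • (A * Aᴴ + (A * Aᴴ).map (starRingEnd ℂ))))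
    (t : ℝ) (ht : t ≠ 0) :
    (Matrix.of fun i j : Fin n => ∫ x : ℝ, specKernel D A t x i j).PosDef ∧
    IsUnit (Matrix.of fun i j : Fin n => ∫ x : ℝ, specKernel D A t x i j) := by
  have hspec : ∀ μ ∈ spectrum ℂ D, |μ.re| < 1 / 2 := by
    intro μ hμ
    have hmem : μ + 1 / 2 ∈ spectrum ℂ (H.map Complex.ofReal) := by
      have hHD : H.map Complex.ofReal = algebraMap ℂ (Matrix (Fin n) (Fin n) ℂ) (1 / 2) + D := by
        rw [hD, Algebra.algebraMap_eq_smul_one, add_sub_cancel]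
      rwa [hHD, spectrum.add_mem_add_iff]
    have h := hH _ hmem
    simp only [Complex.add_re] at h
    norm_num at h
    rw [abs_lt]
    constructor <;> linarith
  have hpd : (Matrix.of fun i j : Fin n => ∫ x : ℝ, specKernel D A t x i j).PosDef := by
    refine posDef_of_integral (integrable_specKernel_apply hspec A t)
      (specKernel_posSemidef D A t) fun v hv hae => ?_
    have hae' : ∀ᵐ x : ℝ, star v ⬝ᵥ (specKernel D A t (-x) *ᵥ v) = 0 :=
      (Measure.measurePreserving_neg (volume : Measure ℝ)).quasiMeasurePreserving.ae hae
    have hIoo : ∀ᵐ x : ℝ, x ∉ Set.Ioo 0 (1 / |t|) := by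
      filter_upwards [hae, hae'] with x h1 h2 hx
      have h := (specKernel_add_specKernel_neg_posDef D A hA ht hx.1 hx.2).dotProduct_mulVec_pos hv
      rw [add_mulVec, dotProduct_add, h1, h2, add_zero] at h
      exact lt_irrefl _ h
    have hvol := measure_eq_zero_iff_ae_notMem.mpr hIoo
    rw [Real.volume_Ioo, ENNReal.ofReal_eq_zero, sub_zero] at hvol
    have : 0 < 1 / |t| := by positivity
    linarith
  exact ⟨hpd, hpd.isUnit⟩
end

section
/- There is no operator fractional Brownian motion with exponent H = [[1,0],[1,1]]. Precisely: let X = (X(t))_{t∈ℝ} = ((X_1(t), X_2(t)))_{t∈ℝ} be an ℝ²-valued Gaussian process with stationary increments which is operator self-similar with exponent H = [[1,0],[1,1]] (so that c^H = [[c,0],[c·log c, c]] for c > 0). Then for every t ∈ ℝ, X_1(t) = 0 almost surely and X_2(t) = t·X_2(1) almost surely; in particular X is not proper. -/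
open MeasureTheory Matrix

/-- Two `ℝ`-indexed processes have the same finite-dimensional distributions. -/
def SameFDD {Ω : Type*} [MeasurableSpace Ω] (μ : Measure Ω) {E : Type*} [MeasurableSpace E]
    (X Y : ℝ → Ω → E) : Prop :=
  ∀ (m : ℕ) (ts : Fin m → ℝ),
    Measure.map (fun ω (k : Fin m) => X (ts k) ω) μ =
      Measure.map (fun ω (k : Fin m) => Y (ts k) ω) μ

/-- An `ℝⁿ`-valued process is a Gaussian process: every (finite) real linear combination of
its values is a real Gaussian random variable. -/
def IsGaussianProcess {Ω : Type*} [MeasurableSpace Ω] (μ : Measure Ω) {n : ℕ}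
    (X : ℝ → Ω → (Fin n → ℝ)) : Prop :=
  ∀ (m : ℕ) (ts : Fin m → ℝ) (a : Fin m → Fin n → ℝ),
    ∃ (mean : ℝ) (v : NNReal),
      Measure.map (fun ω => ∑ k : Fin m, ∑ i : Fin n, a k i * X (ts k) ω i) μ =
        ProbabilityTheory.gaussianReal mean v

theorem SameFDD.integral_comp {Ω E : Type*} [MeasurableSpace Ω] [MeasurableSpace E]
    {μ : Measure Ω} {X Y : ℝ → Ω → E} (h : SameFDD μ X Y) (hX : ∀ t, Measurable (X t))
    (hY : ∀ t, Measurable (Y t)) {f : E → ℝ} (hf : Measurable f) (t : ℝ) :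
    ∫ ω, f (X t ω) ∂μ = ∫ ω, f (Y t ω) ∂μ := by
  have key := congrArg (fun ν => ∫ x : Fin 1 → E, f (x 0) ∂ν) (h 1 fun _ => t)
  have hf' : Measurable fun x : Fin 1 → E => f (x 0) := hf.comp (measurable_pi_apply 0)
  beta_reduce at key
  rwa [integral_map (measurable_pi_lambda _ fun _ => hX t).aemeasurable hf'.aestronglyMeasurable,
    integral_map (measurable_pi_lambda _ fun _ => hY t).aemeasurable hf'.aestronglyMeasurable]
    at key

theorem IsGaussianProcess.memLp_two {Ω : Type*} [MeasurableSpace Ω] {μ : Measure Ω} {n : ℕ}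
    {X : ℝ → Ω → (Fin n → ℝ)} (h : IsGaussianProcess μ X) (hX : ∀ t, Measurable (X t))
    (t : ℝ) (i : Fin n) : MemLp (fun ω => X t ω i) 2 μ := by
  obtain ⟨m, v, hmv⟩ := h 1 (fun _ => t) fun _ => Pi.single i 1
  simp only [Fin.sum_univ_one, Pi.single_apply, ite_mul, one_mul, zero_mul,
    Finset.sum_ite_eq', Finset.mem_univ, if_true] at hmv
  have hL : MemLp id 2 (Measure.map (fun ω => X t ω i) μ) :=
    hmv ▸ ProbabilityTheory.memLp_id_gaussianReal' 2 ENNReal.ofNat_ne_top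
  exact hL.comp_of_map ((measurable_pi_apply i).comp (hX t)).aemeasurable

theorem ae_eq_zero_of_integral_sq_eq_zero {Ω : Type*} [MeasurableSpace Ω] {μ : Measure Ω}
    {f : Ω → ℝ} (hf : MemLp f 2 μ) (h : ∫ ω, f ω ^ 2 ∂μ = 0) : ∀ᵐ ω ∂μ, f ω = 0 := by
  filter_upwards [(integral_eq_zero_iff_of_nonneg (fun ω => sq_nonneg (f ω))
    hf.integrable_sq).1 h] with ω hω
  exact pow_eq_zero_iff two_ne_zero |>.1 hω

/-- A process whose increments and values have the second moments of a self-similar process of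
exponent `1` with stationary increments is linear in time. -/
theorem ae_eq_mul_of_integral_sq {Ω : Type*} [MeasurableSpace Ω] {μ : Measure Ω}
    {Y : ℝ → Ω → ℝ} (hL : ∀ t, MemLp (Y t) 2 μ)
    (hinc : ∀ t s, ∫ ω, (Y t ω - Y s ω) ^ 2 ∂μ = ∫ ω, Y (t - s) ω ^ 2 ∂μ)
    (hss : ∀ c, 0 < c → ∫ ω, Y c ω ^ 2 ∂μ = c ^ 2 * ∫ ω, Y 1 ω ^ 2 ∂μ) (t : ℝ) :
    ∀ᵐ ω ∂μ, Y t ω = t * Y 1 ω := by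
  have hsymm (s : ℝ) : ∫ ω, Y (-s) ω ^ 2 ∂μ = ∫ ω, Y s ω ^ 2 ∂μ := by
    rw [← zero_sub, ← hinc, ← sub_zero s, ← hinc]
    simp only [sub_zero]
    congr 1 with ω
    ring
  have hsq (s : ℝ) : ∫ ω, Y s ω ^ 2 ∂μ = s ^ 2 * ∫ ω, Y 1 ω ^ 2 ∂μ := by
    rcases lt_trichotomy s 0 with hs | rfl | hs
    · rw [← hsymm, hss _ (neg_pos.2 hs), neg_sq]
    · have := hinc 0 0
      simp only [sub_self, ne_eq, OfNat.ofNat_ne_zero, not_false_eq_true, zero_pow,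
        integral_zero] at this
      rw [← this]
      simp
    · exact hss s hs
  have hmul (s r : ℝ) : Integrable (fun ω => Y s ω * Y r ω) μ := (hL s).integrable_mul (hL r)
  have hexpand (a : ℝ) : ∫ ω, (Y t ω - a * Y 1 ω) ^ 2 ∂μ =
      ∫ ω, Y t ω ^ 2 ∂μ - 2 * a * ∫ ω, Y t ω * Y 1 ω ∂μ + a ^ 2 * ∫ ω, Y 1 ω ^ 2 ∂μ := by
    have hcross := (hmul t 1).const_mul (2 * a)
    rw [← integral_const_mul, ← integral_const_mul, ← integral_sub (hL t).integrable_sq hcross,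
      ← integral_add (f := fun ω => Y t ω ^ 2 - 2 * a * (Y t ω * Y 1 ω))
        ((hL t).integrable_sq.sub hcross) ((hL 1).integrable_sq.const_mul _)]
    congr 1 with ω
    ring
  have hcross := hexpand 1
  simp only [one_mul, hinc, hsq (t - 1), hsq t] at hcross
  have hzero : ∫ ω, (Y t ω - t * Y 1 ω) ^ 2 ∂μ = 0 := by
    rw [hexpand, hsq t]
    linear_combination -t * hcross
  filter_upwards [ae_eq_zero_of_integral_sq_eq_zero ((hL t).sub ((hL 1).const_mul t)) hzero]
    with ω hω
  exact sub_eq_zero.1 hω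

theorem exp_smul_jordan (a : ℝ) :
    NormedSpace.exp (a • (!![1, 0; 1, 1] : Matrix (Fin 2) (Fin 2) ℝ)) =
      !![Real.exp a, 0; a * Real.exp a, Real.exp a] := by
  have hsplit : a • (!![1, 0; 1, 1] : Matrix (Fin 2) (Fin 2) ℝ) =
      diagonal (fun _ => a) + !![0, 0; a, 0] := by
    ext i j
    fin_cases i <;> fin_cases j <;> simp
  have hcomm : Commute (diagonal fun _ => a) (!![0, 0; a, 0] : Matrix (Fin 2) (Fin 2) ℝ) := by
    ext i j
    fin_cases i <;> fin_cases j <;> simp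
  have hsq : (!![0, 0; a, 0] : Matrix (Fin 2) (Fin 2) ℝ) ^ 2 = 0 := by
    ext i j
    fin_cases i <;> fin_cases j <;> simp [sq]
  have hnil : NormedSpace.exp (!![0, 0; a, 0] : Matrix (Fin 2) (Fin 2) ℝ) =
      1 + !![0, 0; a, 0] := by
    rw [congrFun (NormedSpace.exp_eq_tsum ℝ) _, tsum_eq_sum (s := Finset.range 2)]
    · simp [Finset.sum_range_succ]
    · intro k hk
      rw [pow_eq_zero_of_le (not_lt.1 fun h => hk (Finset.mem_range.2 h)) hsq, smul_zero]
  rw [hsplit, Matrix.exp_add_of_commute _ _ hcomm, hnil, Matrix.exp_diagonal]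
  ext i j
  fin_cases i <;> fin_cases j <;> simp [Pi.coe_exp, Real.exp_eq_exp_ℝ, mul_comm]

/-- There is no operator fractional Brownian motion with exponent `H = [[1,0],[1,1]]`:
any `ℝ²`-valued Gaussian process with stationary increments, continuous in law and operator
self-similar with this exponent satisfies `X₁(t) = 0` a.s. and `X₂(t) = t X₂(1)` a.s. for
every `t`; in particular it is not proper. -/
theorem stmt17 {Ω : Type*} [MeasurableSpace Ω] (μ : Measure Ω) [IsProbabilityMeasure μ]
    (X : ℝ → Ω → (Fin 2 → ℝ))
    (hmeas : ∀ t : ℝ, Measurable (X t))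
    (hgauss : IsGaussianProcess μ X)
    (hincr : ∀ h : ℝ,
      SameFDD μ (fun t ω => X (t + h) ω - X h ω) (fun t ω => X t ω - X 0 ω))
    (hcont : ∀ f : BoundedContinuousFunction (Fin 2 → ℝ) ℝ,
      Continuous fun t : ℝ => ∫ ω, f (X t ω) ∂μ)
    (hss : ∀ c : ℝ, 0 < c →
      SameFDD μ (fun t => X (c * t))
        (fun t ω => (NormedSpace.exp (Real.log c • (!![1, 0; 1, 1] : Matrix (Fin 2) (Fin 2) ℝ))).mulVec (X t ω))) :
    (∀ t : ℝ, (∀ᵐ ω ∂μ, X t ω 0 = 0) ∧ (∀ᵐ ω ∂μ, X t ω 1 = t * X 1 ω 1)) ∧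
    ¬ (∀ t : ℝ, t ≠ 0 → ∀ v : Fin 2 → ℝ, v ≠ 0 →
        ¬ (∀ᵐ ω ∂μ, (∑ i : Fin 2, v i * X t ω i) = 0)) := by
  have hL := hgauss.memLp_two hmeas
  have hself (c : ℝ) (hc : 0 < c) (t : ℝ) (f : (Fin 2 → ℝ) → ℝ) (hf : Measurable f) :
      ∫ ω, f (X (c * t) ω) ∂μ =
        ∫ ω, f ![c * X t ω 0, c * (Real.log c * X t ω 0 + X t ω 1)] ∂μ := by
    have heq (ω : Ω) : (NormedSpace.exp (Real.log c •
        (!![1, 0; 1, 1] : Matrix (Fin 2) (Fin 2) ℝ))).mulVec (X t ω) =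
          ![c * X t ω 0, c * (Real.log c * X t ω 0 + X t ω 1)] := by
      rw [exp_smul_jordan, Real.exp_log hc]
      ext i
      fin_cases i <;> simp [Matrix.mulVec, dotProduct, Fin.sum_univ_two] <;> ring
    have := (hss c hc).integral_comp (fun t => hmeas (c * t))
      (fun t => (Continuous.matrix_mulVec continuous_const continuous_id).measurable.comp
        (hmeas t)) hf t
    simpa only [heq] using this
  have hself₀ (c : ℝ) (hc : 0 < c) (t : ℝ) :
      ∫ ω, X (c * t) ω 0 ^ 2 ∂μ = c ^ 2 * ∫ ω, X t ω 0 ^ 2 ∂μ := by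
    rw [hself c hc t (fun v => v 0 ^ 2) (by fun_prop), ← integral_const_mul]
    simp [mul_pow]
  have hself₁ (c : ℝ) (hc : 0 < c) (t : ℝ) (ht : ∀ᵐ ω ∂μ, X t ω 0 = 0) :
      ∫ ω, X (c * t) ω 1 ^ 2 ∂μ = c ^ 2 * ∫ ω, X t ω 1 ^ 2 ∂μ := by
    rw [hself c hc t (fun v => v 1 ^ 2) (by fun_prop), ← integral_const_mul]
    refine integral_congr_ae ?_
    filter_upwards [ht] with ω hω
    simp [hω, mul_pow]
  have hzero₀ : ∀ᵐ ω ∂μ, X 0 ω 0 = 0 := by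
    refine ae_eq_zero_of_integral_sq_eq_zero (hL 0 0) ?_
    have := hself₀ 2 two_pos 0
    rw [mul_zero] at this
    linarith
  have hzero₁ : ∀ᵐ ω ∂μ, X 0 ω 1 = 0 := by
    refine ae_eq_zero_of_integral_sq_eq_zero (hL 0 1) ?_
    have := hself₁ 2 two_pos 0 hzero₀
    rw [mul_zero] at this
    linarith
  have hzero : ∀ᵐ ω ∂μ, X 0 ω = 0 := by
    filter_upwards [hzero₀, hzero₁] with ω h₀ h₁
    ext i
    fin_cases i
    · exact h₀
    · exact h₁
  have hstat (f : (Fin 2 → ℝ) → ℝ) (hf : Measurable f) (t s : ℝ) :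
      ∫ ω, f (X t ω - X s ω) ∂μ = ∫ ω, f (X (t - s) ω) ∂μ := by
    have := (hincr s).integral_comp (fun t => (hmeas (t + s)).sub (hmeas s))
      (fun t => (hmeas t).sub (hmeas 0)) hf (t - s)
    rw [sub_add_cancel] at this
    rw [this]
    refine integral_congr_ae ?_
    filter_upwards [hzero] with ω hω
    rw [hω, sub_zero]
  have hlin₀ (t : ℝ) : ∀ᵐ ω ∂μ, X t ω 0 = t * X 1 ω 0 :=
    ae_eq_mul_of_integral_sq (Y := fun t ω => X t ω 0) (fun t => hL t 0)
      (fun t s => hstat (fun v => v 0 ^ 2) (by fun_prop) t s)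
      (fun c hc => by simpa using hself₀ c hc 1) t
  have hX₁ : ∀ᵐ ω ∂μ, X 1 ω 0 = 0 := by
    refine ae_eq_zero_of_integral_sq_eq_zero (hL 1 0) ?_
    have hi (t : ℝ) : Integrable (fun ω => X 1 ω 0 * X t ω 1) μ := (hL 1 0).integrable_mul (hL t 1)
    have hadd : ∫ ω, X 1 ω 0 * X 2 ω 1 ∂μ - ∫ ω, X 1 ω 0 * X 1 ω 1 ∂μ =
        ∫ ω, X 1 ω 0 * X 1 ω 1 ∂μ := by
      have := hstat (fun v => v 0 * v 1) (by fun_prop) 2 1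
      norm_num at this
      rw [← integral_sub (hi 2) (hi 1), ← this]
      refine integral_congr_ae ?_
      filter_upwards [hlin₀ 2] with ω hω
      rw [hω]
      ring
    have hscale : 2 * ∫ ω, X 1 ω 0 * X 2 ω 1 ∂μ =
        4 * ∫ ω, X 1 ω 0 * X 1 ω 1 ∂μ + 4 * Real.log 2 * ∫ ω, X 1 ω 0 ^ 2 ∂μ := by
      have := hself 2 two_pos 1 (fun v => v 0 * v 1) (by fun_prop)
      rw [mul_one] at this
      rw [← integral_const_mul, ← integral_const_mul, ← integral_const_mul,
        ← integral_add ((hi 1).const_mul _) ((hL 1 0).integrable_sq.const_mul _)]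
      refine Eq.trans (integral_congr_ae ?_) (this.trans ?_)
      · filter_upwards [hlin₀ 2] with ω hω
        rw [hω]
        ring
      · congr 1 with ω
        simp only [cons_val_zero, cons_val_one]
        ring
    have hlog : Real.log 2 * ∫ ω, X 1 ω 0 ^ 2 ∂μ = 0 := by linarith
    exact (mul_eq_zero.1 hlog).resolve_left (Real.log_pos one_lt_two).ne'
  have hX (t : ℝ) : ∀ᵐ ω ∂μ, X t ω 0 = 0 := by
    filter_upwards [hlin₀ t, hX₁] with ω h₀ h₁
    rw [h₀, h₁, mul_zero]
  refine ⟨fun t => ⟨hX t, ?_⟩, fun h => ?_⟩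
  · exact ae_eq_mul_of_integral_sq (Y := fun t ω => X t ω 1) (fun t => hL t 1)
      (fun t s => hstat (fun v => v 1 ^ 2) (by fun_prop) t s)
      (fun c hc => by simpa using hself₁ c hc 1 hX₁) t
  · refine h 1 one_ne_zero ![1, 0] (fun hv => by simpa using congrFun hv 0) ?_
    filter_upwards [hX₁] with ω hω
    simp [Fin.sum_univ_two, hω]
end
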